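/- arXiv:math/0407196 — 7 statements merged into one kernel-verified Lean document; each statement's English description precedes it below -/
import Mathlib

section
/- If S ⊆ κ is r-admissible, then there is a (unique) continuous map r_S : C_S → C_S satisfying r_S(pr_S(x)) = pr_S(r(x)) for every x ∈ C; moreover the range of r_S is contained in X_S and r_S(y) = y for every y ∈ X_S, i.e. r_S is an internal retraction of C_S onto X_S. -/
/-- A set `S` of indices is `r`-admissible if `x↾S = x'↾S` implies `r(x)↾S = r(x')↾S`. -/
def Admissible {κ : Type*} {C : κ → Type*} (r : (∀ α, C α) → ∀ α, C α) (S : Set κ) : Prop :=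
  ∀ x x' : ∀ α, C α, S.restrict x = S.restrict x' → S.restrict (r x) = S.restrict (r x')

/-- `X_S`, the image of `X` under the coordinate projection `pr_S`. -/
def XS {κ : Type*} {C : κ → Type*} (X : Set (∀ α, C α)) (S : Set κ) : Set (∀ α : S, C α) :=
  S.restrict '' X

/-- `p_S : X → X_S`, the restriction of the coordinate projection. -/
def pS {κ : Type*} {C : κ → Type*} (X : Set (∀ α, C α)) (S : Set κ) (x : X) : XS X S :=
  ⟨S.restrict x.1, x.1, x.2, rfl⟩

/-- For `A ⊆ B`, the bonding map `p^B_A : X_B → X_A`, restriction of coordinates. -/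
def pBA {κ : Type*} {C : κ → Type*} (X : Set (∀ α, C α)) {A B : Set κ} (hAB : A ⊆ B)
    (y : XS X B) : XS X A :=
  ⟨fun α => y.1 ⟨α.1, hAB α.2⟩, by
    obtain ⟨x, hx, hxy⟩ := y.2
    exact ⟨x, hx, by rw [← hxy]; rfl⟩⟩

/-- The coordinate projection `C → C_S` of a product of nonempty spaces has a continuous section. -/
theorem exists_continuous_section_restrict {κ : Type*} {C : κ → Type*}
    [∀ α, TopologicalSpace (C α)] [∀ α, Nonempty (C α)] (S : Set κ) :
    ∃ e : (∀ α : S, C α) → ∀ α, C α, Continuous e ∧ ∀ y, S.restrict (e y) = y := by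
  classical
  refine ⟨fun y α => if h : α ∈ S then y ⟨α, h⟩ else Classical.arbitrary (C α), ?_, ?_⟩
  · refine continuous_pi fun α => ?_
    by_cases h : α ∈ S
    · simpa [h] using continuous_apply (⟨α, h⟩ : S)
    · simpa [h] using continuous_const
  · intro y
    funext α
    exact dif_pos α.2

/-- If `S` is `r`-admissible, there is a unique map `r_S : C_S → C_S` with
`r_S ∘ pr_S = pr_S ∘ r`; it is continuous, its range is contained in `X_S`, and it fixes
`X_S` pointwise, i.e. it is an internal retraction of `C_S` onto `X_S`. -/
theorem statement0 {κ : Type*} {C : κ → Type*} [∀ α, MetricSpace (C α)]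
    [∀ α, CompactSpace (C α)] [∀ α, Nonempty (C α)]
    {X : Set (∀ α, C α)} {r : (∀ α, C α) → ∀ α, C α}
    (hr : Continuous r) (hrX : ∀ z, r z ∈ X) (hfix : ∀ x ∈ X, r x = x)
    {S : Set κ} (hS : Admissible r S) :
    ∃ rS : (∀ α : S, C α) → ∀ α : S, C α,
      (Continuous rS ∧ (∀ x : ∀ α, C α, rS (S.restrict x) = S.restrict (r x)) ∧
        Set.range rS ⊆ XS X S ∧ ∀ y ∈ XS X S, rS y = y) ∧
      ∀ g : (∀ α : S, C α) → ∀ α : S, C α,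
        (∀ x : ∀ α, C α, g (S.restrict x) = S.restrict (r x)) → g = rS := by
  obtain ⟨e, he, hes⟩ := exists_continuous_section_restrict (C := C) S
  have hcomm (x : ∀ α, C α) : S.restrict (r (e (S.restrict x))) = S.restrict (r x) :=
    hS _ _ (hes _)
  refine ⟨fun y => S.restrict (r (e y)), ⟨?_, hcomm, ?_, ?_⟩, ?_⟩
  · exact (Pi.continuous_domRestrict S).comp (hr.comp he)
  · rintro _ ⟨y, rfl⟩
    exact ⟨r (e y), hrX _, rfl⟩
  · rintro _ ⟨x, hx, rfl⟩
    exact (hcomm x).trans (by rw [hfix x hx])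
  · intro g hg
    funext y
    rw [← hg, hes]
end

section
/- If S ⊆ κ is r-admissible, then the map p_S : X → X_S is a retraction, i.e. there exists a continuous map j : X_S → X with p_S ∘ j = id_{X_S}. -/
/-- If `S` is `r`-admissible, then `p_S : X → X_S` is a retraction:
there is a continuous map `j : X_S → X` with `p_S ∘ j = id`. -/
theorem statement1 {κ : Type*} {C : κ → Type*} [∀ α, MetricSpace (C α)]
    [∀ α, CompactSpace (C α)] [∀ α, Nonempty (C α)]
    {X : Set (∀ α, C α)} {r : (∀ α, C α) → ∀ α, C α}
    (hr : Continuous r) (hrX : ∀ z, r z ∈ X) (hfix : ∀ x ∈ X, r x = x)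
    {S : Set κ} (hS : Admissible r S) :
    ∃ j : XS X S → X, Continuous j ∧ ∀ y : XS X S, pS X S (j y) = y := by
  classical
  let extend (y : ∀ α : S, C α) (α : κ) : C α :=
    if h : α ∈ S then y ⟨α, h⟩ else Classical.arbitrary (C α)
  have extend_continuous : Continuous extend := by
    refine continuous_pi fun α => ?_
    by_cases h : α ∈ S
    · simpa only [extend, dif_pos h] using continuous_apply (⟨α, h⟩ : S)
    · simpa only [extend, dif_neg h] using continuous_const
  have restrict_extend (y : ∀ α : S, C α) : S.restrict (extend y) = y :=
    funext fun α => dif_pos α.2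
  refine ⟨fun y => ⟨r (extend y.1), hrX _⟩,
    (hr.comp (extend_continuous.comp continuous_subtype_val)).subtype_mk _, ?_⟩
  rintro ⟨_, x, hx, rfl⟩
  apply Subtype.ext
  change S.restrict (r (extend (S.restrict x))) = S.restrict x
  rw [hS _ x (restrict_extend _), hfix x hx]
end

section
/- If S ⊆ κ is r-admissible, then the map p_S : X → X_S is an open map (where X carries the subspace topology from C and X_S the subspace topology from C_S). -/
/-- If `S` is `r`-admissible, then `p_S : X → X_S` is an open map
(for the subspace topologies). -/
theorem statement2 {κ : Type*} {C : κ → Type*} [∀ α, MetricSpace (C α)]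
    [∀ α, CompactSpace (C α)] [∀ α, Nonempty (C α)]
    {X : Set (∀ α, C α)} {r : (∀ α, C α) → ∀ α, C α}
    (hr : Continuous r) (hrX : ∀ z, r z ∈ X) (hfix : ∀ x ∈ X, r x = x)
    {S : Set κ} (hS : Admissible r S) :
    IsOpenMap (pS X S) := by
  classical
  refine IsOpenMap.of_sections fun x => ?_
  let glue : XS X S → ∀ α, C α := fun y α => if h : α ∈ S then y.1 ⟨α, h⟩ else x.1 α
  have restrict_glue (y : XS X S) : S.restrict (glue y) = y.1 := by
    ext α
    exact dif_pos α.2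
  have glue_pS : glue (pS X S x) = x.1 := by
    ext α
    by_cases h : α ∈ S
    · exact dif_pos h
    · exact dif_neg h
  have continuous_glue : Continuous glue := by
    refine continuous_pi fun α => ?_
    by_cases h : α ∈ S
    · simpa only [glue, h, dif_pos, Function.comp_def] using
        (continuous_apply (⟨α, h⟩ : S)).comp
          (continuous_subtype_val : Continuous fun y : XS X S => y.1)
    · simpa only [glue, h, dif_neg, not_false_eq_true] using continuous_const
  refine ⟨fun y => ⟨r (glue y), hrX _⟩,
    ((hr.comp continuous_glue).subtype_mk _).continuousAt, ?_, fun y => ?_⟩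
  · exact Subtype.ext ((congrArg r glue_pS).trans (hfix x.1 x.2))
  · obtain ⟨x', hx', hy⟩ := y.2
    refine Subtype.ext ?_
    change S.restrict (r (glue y)) = y.1
    rw [hS (glue y) x' ((restrict_glue y).trans hy.symm), hfix x' hx', hy]
end

section
/- Every countable subset of κ is contained in a countable r-admissible subset of κ. -/
/-- Every entourage of a product contains all pairs agreeing on some finite set of coordinates. -/
theorem exists_finite_eqOn_subset_of_mem_uniformity_pi {ι : Type*} {C : ι → Type*}
    [∀ i, UniformSpace (C i)] {U : Set ((∀ i, C i) × ∀ i, C i)}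
    (hU : U ∈ uniformity (∀ i, C i)) :
    ∃ I : Set ι, I.Finite ∧ ∀ x y : ∀ i, C i, (∀ i ∈ I, x i = y i) → (x, y) ∈ U := by
  rw [Pi.uniformity, Filter.mem_iInf] at hU
  obtain ⟨I, hI, V, hV, rfl⟩ := hU
  refine ⟨I, hI, fun x y hxy => Set.mem_iInter.2 fun i => ?_⟩
  obtain ⟨W, hW, hWV⟩ := hV i
  apply hWV
  simpa [hxy i i.2] using refl_mem_uniformity hW

/-- A uniformly continuous map from a product to a metric space depends on countably many
coordinates. -/
theorem UniformContinuous.exists_countable_dependsOn {ι : Type*} {C : ι → Type*} {Y : Type*}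
    [∀ i, UniformSpace (C i)] [MetricSpace Y] {f : (∀ i, C i) → Y} (hf : UniformContinuous f) :
    ∃ S : Set ι, S.Countable ∧ DependsOn f S := by
  have h (n : ℕ) := exists_finite_eqOn_subset_of_mem_uniformity_pi
    (hf (Metric.dist_mem_uniformity (Nat.one_div_pos_of_nat (α := ℝ) (n := n))))
  choose I hI hclose using h
  refine ⟨⋃ n, I n, Set.countable_iUnion fun n => (hI n).countable, fun x y hxy => ?_⟩
  refine eq_of_forall_dist_le fun ε hε => ?_
  obtain ⟨n, hn⟩ := exists_nat_one_div_lt hε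
  have hlt : dist (f x) (f y) < 1 / ((n : ℝ) + 1) :=
    hclose n x y fun i hi => hxy i (Set.mem_iUnion_of_mem n hi)
  exact (hlt.trans hn).le

/-- A countable set is contained in a countable set closed under a countable-set-valued map. -/
theorem Set.Countable.exists_countable_superset_closed {ι : Type*} {T : Set ι}
    (hT : T.Countable) {F : ι → Set ι} (hF : ∀ i, (F i).Countable) :
    ∃ S : Set ι, T ⊆ S ∧ S.Countable ∧ ∀ i ∈ S, F i ⊆ S := by
  let A : ℕ → Set ι := fun n => Nat.rec T (fun _ B => ⋃ i ∈ B, F i) n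
  have hA (n : ℕ) : (A n).Countable := by
    induction n with
    | zero => exact hT
    | succ n ih => exact ih.biUnion fun i _ => hF i
  refine ⟨⋃ n, A n, Set.subset_iUnion A 0, Set.countable_iUnion hA, fun i hi => ?_⟩
  obtain ⟨n, hn⟩ := Set.mem_iUnion.1 hi
  exact (Set.subset_biUnion_of_mem (u := F) hn).trans (Set.subset_iUnion A (n + 1))

/-- Every countable subset of `κ` is contained in a countable
`r`-admissible subset of `κ`. -/
theorem statement4 {κ : Type*} {C : κ → Type*} [∀ α, MetricSpace (C α)]
    [∀ α, CompactSpace (C α)] [∀ α, Nonempty (C α)]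
    {X : Set (∀ α, C α)} {r : (∀ α, C α) → ∀ α, C α}
    (hr : Continuous r) (hrX : ∀ z, r z ∈ X) (hfix : ∀ x ∈ X, r x = x)
    (T : Set κ) (hT : T.Countable) :
    ∃ S : Set κ, T ⊆ S ∧ S.Countable ∧ Admissible r S := by
  have h (α : κ) := (CompactSpace.uniformContinuous_of_continuous
    ((continuous_apply α).comp hr)).exists_countable_dependsOn
  choose F hF hdep using h
  obtain ⟨S, hTS, hS, hclosed⟩ := hT.exists_countable_superset_closed hF
  refine ⟨S, hTS, hS, fun x x' hxx' => funext fun α => ?_⟩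
  exact hdep α fun β hβ => congrFun hxx' ⟨β, hclosed α α.2 hβ⟩
end

section
/- Let q : Y → Z be a continuous surjection between topological spaces that is both an open map and a closed map, and let f : Y → ℝ be a bounded continuous function. Then the function φ : Z → ℝ defined by φ(z) = sup{f(y) : y ∈ Y, q(y) = z} is continuous. -/
/-- If `q : Y → Z` is a continuous open and closed surjection and
`f : Y → ℝ` is bounded and continuous, then `z ↦ sup {f y : q y = z}` is continuous. -/
theorem statement6 {Y Z : Type*} [TopologicalSpace Y] [TopologicalSpace Z]
    (q : Y → Z) (hq : Continuous q) (hqsurj : Function.Surjective q)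
    (hqopen : IsOpenMap q) (hqclosed : IsClosedMap q)
    (f : Y → ℝ) (hf : Continuous f) (hbdd : ∃ M : ℝ, ∀ y, |f y| ≤ M) :
    Continuous fun z : Z => sSup (f '' (q ⁻¹' {z})) := by
  obtain ⟨M, hM⟩ := hbdd
  have hne : ∀ z, (f '' (q ⁻¹' {z})).Nonempty := fun z =>
    let ⟨y, hy⟩ := hqsurj z
    ⟨f y, y, hy, rfl⟩
  have hbdd : ∀ z, BddAbove (f '' (q ⁻¹' {z})) := by
    rintro z
    refine ⟨M, ?_⟩
    rintro _ ⟨y, -, rfl⟩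
    exact (abs_le.mp (hM y)).2
  refine continuous_iff_continuousAt.mpr fun z => tendsto_order.mpr ⟨fun a ha => ?_, fun a ha => ?_⟩
  · obtain ⟨_, ⟨y, hy, rfl⟩, hay⟩ := exists_lt_of_lt_csSup (hne z) ha
    filter_upwards [(hqopen _ (isOpen_Ioi.preimage hf)).mem_nhds ⟨y, hay, hy⟩]
    rintro _ ⟨x, hx, rfl⟩
    exact lt_of_lt_of_le hx (le_csSup (hbdd _) ⟨x, rfl, rfl⟩)
  · obtain ⟨b, hzb, hba⟩ := exists_between ha
    have hz : z ∈ (q '' (f ⁻¹' Set.Ici b))ᶜ := by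
      rintro ⟨y, hy, hyz⟩
      exact (lt_of_le_of_lt (le_csSup (hbdd z) ⟨y, hyz, rfl⟩) hzb).not_ge hy
    filter_upwards [(hqclosed _ (isClosed_Ici.preimage hf)).isOpen_compl.mem_nhds hz] with w hw
    refine lt_of_le_of_lt (csSup_le (hne w) ?_) hba
    rintro _ ⟨y, hy, rfl⟩
    exact le_of_not_ge fun h => hw ⟨y, h, hy⟩
end

section
/- If A ⊆ B ⊆ κ and A is r-admissible, then the bonding map p^B_A : X_B → X_A (defined by p^B_A(y) = y↾A) is an open map. -/
open Classical in
/-- The point of the product with coordinates `a` on `A` and those of `x` elsewhere. -/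
noncomputable def glue {κ : Type*} {C : κ → Type*} (A : Set κ) (x : ∀ α, C α)
    (a : ∀ α : A, C α) : ∀ α, C α :=
  fun α => if h : α ∈ A then a ⟨α, h⟩ else x α

theorem restrict_glue {κ : Type*} {C : κ → Type*} (A : Set κ) (x : ∀ α, C α)
    (a : ∀ α : A, C α) : A.restrict (glue A x a) = a :=
  funext fun α => dif_pos α.2

theorem glue_restrict_self {κ : Type*} {C : κ → Type*} (A : Set κ) (x : ∀ α, C α) :
    glue A x (A.restrict x) = x := by
  funext α
  simp [glue, Set.restrict]

theorem continuous_glue {κ : Type*} {C : κ → Type*} [∀ α, TopologicalSpace (C α)] (A : Set κ)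
    (x : ∀ α, C α) : Continuous (glue A x) := by
  refine continuous_pi fun α => ?_
  by_cases h : α ∈ A
  · simpa [glue, h] using continuous_apply (⟨α, h⟩ : A)
  · simpa [glue, h] using continuous_const

/-- If `A` is admissible for a retraction `r` onto `X`, then `r` does not change the
`A`-coordinates of a point whose restriction to `A` lies in `X_A`. -/
theorem Admissible.restrict_apply_glue {κ : Type*} {C : κ → Type*} {X : Set (∀ α, C α)}
    {r : (∀ α, C α) → ∀ α, C α} {A : Set κ} (hA : Admissible r A)
    (hfix : ∀ x ∈ X, r x = x) (x : ∀ α, C α) {a : ∀ α : A, C α} (ha : a ∈ XS X A) :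
    A.restrict (r (glue A x a)) = a := by
  obtain ⟨z, hz, rfl⟩ := ha
  rw [hA _ z (restrict_glue A x _), hfix z hz]

/-- If `A ⊆ B ⊆ κ` and `A` is `r`-admissible, then the bonding map
`p^B_A : X_B → X_A` is an open map. -/
theorem statement10 {κ : Type*} {C : κ → Type*} [∀ α, MetricSpace (C α)]
    [∀ α, CompactSpace (C α)] [∀ α, Nonempty (C α)]
    {X : Set (∀ α, C α)} {r : (∀ α, C α) → ∀ α, C α}
    (hr : Continuous r) (hrX : ∀ z, r z ∈ X) (hfix : ∀ x ∈ X, r x = x)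
    {A B : Set κ} (hAB : A ⊆ B) (hA : Admissible r A) :
    IsOpenMap (pBA X hAB) := by
  refine IsOpenMap.of_sections ?_
  rintro ⟨_, x, hx, rfl⟩
  refine ⟨fun a => pS X B ⟨r (glue A x a.1), hrX _⟩, Continuous.continuousAt ?_, ?_, ?_⟩
  · exact Continuous.subtype_mk ((Pi.continuous_domRestrict B).comp
      (hr.comp ((continuous_glue A x).comp continuous_subtype_val))) _
  · refine Subtype.ext ?_
    change B.restrict (r (glue A x (A.restrict x))) = B.restrict x
    rw [glue_restrict_self, hfix x hx]
  · exact fun a => Subtype.ext (hA.restrict_apply_glue hfix x a.2)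
end

section
/- If A ⊆ B ⊆ κ and A is r-admissible, then the bonding map p^B_A : X_B → X_A is a retraction, i.e. there exists a continuous map j : X_A → X_B with p^B_A ∘ j = id_{X_A}. -/
/-- Extend a point given on the coordinates in `A` by a base point `c` elsewhere. -/
noncomputable def extendBy {κ : Type*} {C : κ → Type*} (A : Set κ) (c : ∀ α, C α)
    (y : ∀ α : A, C α) (α : κ) : C α :=
  open Classical in if h : α ∈ A then y ⟨α, h⟩ else c α

theorem restrict_extendBy {κ : Type*} {C : κ → Type*} (A : Set κ) (c : ∀ α, C α)
    (y : ∀ α : A, C α) : A.restrict (extendBy A c y) = y := by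
  funext α
  exact dif_pos α.2

theorem continuous_extendBy {κ : Type*} {C : κ → Type*} [∀ α, TopologicalSpace (C α)]
    (A : Set κ) (c : ∀ α, C α) : Continuous (extendBy A c) := by
  refine continuous_pi fun α => ?_
  by_cases h : α ∈ A
  · simpa [extendBy, h] using continuous_apply (⟨α, h⟩ : A)
  · simpa [extendBy, h] using continuous_const

/-- If `A` is admissible, then retracting any extension of `y ∈ X_A` does not change the
coordinates in `A`. -/
theorem Admissible.restrict_retraction_extendBy {κ : Type*} {C : κ → Type*}
    {X : Set (∀ α, C α)} {r : (∀ α, C α) → ∀ α, C α} (hfix : ∀ x ∈ X, r x = x)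
    {A : Set κ} (hA : Admissible r A) (c : ∀ α, C α) {y : ∀ α : A, C α} (hy : y ∈ XS X A) :
    A.restrict (r (extendBy A c y)) = y := by
  obtain ⟨x, hx, rfl⟩ := hy
  rw [hA _ x (restrict_extendBy A c _), hfix x hx]

/-- If `A ⊆ B ⊆ κ` and `A` is `r`-admissible, then the bonding map
`p^B_A : X_B → X_A` is a retraction: it has a continuous right inverse. -/
theorem statement11 {κ : Type*} {C : κ → Type*} [∀ α, MetricSpace (C α)]
    [∀ α, CompactSpace (C α)] [∀ α, Nonempty (C α)]
    {X : Set (∀ α, C α)} {r : (∀ α, C α) → ∀ α, C α}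
    (hr : Continuous r) (hrX : ∀ z, r z ∈ X) (hfix : ∀ x ∈ X, r x = x)
    {A B : Set κ} (hAB : A ⊆ B) (hA : Admissible r A) :
    ∃ j : XS X A → XS X B, Continuous j ∧ ∀ y : XS X A, pBA X hAB (j y) = y := by
  let c : ∀ α, C α := fun _ => Classical.arbitrary _
  refine ⟨fun y => pS X B ⟨r (extendBy A c y.1), hrX _⟩, ?_, fun y => ?_⟩
  · have h : Continuous fun y : XS X A => r (extendBy A c y.1) :=
      hr.comp ((continuous_extendBy A c).comp continuous_subtype_val)
    exact Continuous.subtype_mk (continuous_pi fun α => (continuous_apply α.1).comp h) _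
  · exact Subtype.ext (hA.restrict_retraction_extendBy hfix c y.2)
end
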